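/- Let Y ∈ ℝ^{n×p}, set E := YᵀY − I_p, and let Y₁ := Y((3/2)I_p − (1/2)YᵀY) be one step of the order-1 Newton–Schulz iteration. Then Y₁ᵀY₁ − I_p = −(3/4)E² + (1/4)E³, and if ‖E‖_F ≤ 1 then ‖Y₁ᵀY₁ − I_p‖_F ≤ ‖E‖_F². -/

import Mathlib

open Matrix BigOperators

noncomputable section

/-- Frobenius norm of a real matrix. -/
def frob {m k : ℕ} (A : Matrix (Fin m) (Fin k) ℝ) : ℝ :=
  Real.sqrt (∑ i, ∑ j, (A i j) ^ 2)

section FrobeniusNorm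

open scoped Matrix.Norms.Frobenius

theorem frob_eq_norm {m k : ℕ} (A : Matrix (Fin m) (Fin k) ℝ) : frob A = ‖A‖ := by
  simp [frob, Matrix.frobenius_norm_def, Real.sqrt_eq_rpow]

theorem frob_nonneg {m k : ℕ} (A : Matrix (Fin m) (Fin k) ℝ) : 0 ≤ frob A :=
  Real.sqrt_nonneg _

theorem frob_add_le {m k : ℕ} (A B : Matrix (Fin m) (Fin k) ℝ) :
    frob (A + B) ≤ frob A + frob B := by
  simpa only [frob_eq_norm] using norm_add_le A B

theorem frob_neg {m k : ℕ} (A : Matrix (Fin m) (Fin k) ℝ) : frob (-A) = frob A := by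
  simp [frob]

theorem frob_smul {m k : ℕ} (c : ℝ) (A : Matrix (Fin m) (Fin k) ℝ) :
    frob (c • A) = |c| * frob A := by
  rw [frob_eq_norm, frob_eq_norm, norm_smul, Real.norm_eq_abs]

theorem frob_mul_le {l m k : ℕ} (A : Matrix (Fin l) (Fin m) ℝ) (B : Matrix (Fin m) (Fin k) ℝ) :
    frob (A * B) ≤ frob A * frob B := by
  simpa only [frob_eq_norm] using Matrix.frobenius_norm_mul A B

end FrobeniusNorm

theorem frob_cubic_le {p : ℕ} {E : Matrix (Fin p) (Fin p) ℝ} (hE : frob E ≤ 1) :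
    frob (-((3 / 4 : ℝ) • E ^ 2) + (1 / 4 : ℝ) • E ^ 3) ≤ frob E ^ 2 := by
  have h2 : frob (E ^ 2) ≤ frob E ^ 2 := by
    simpa only [pow_two] using frob_mul_le E E
  have h3 : frob (E ^ 3) ≤ frob E ^ 2 := by
    rw [pow_succ E 2]
    calc frob (E ^ 2 * E) ≤ frob (E ^ 2) * frob E := frob_mul_le _ _
      _ ≤ frob (E ^ 2) := mul_le_of_le_one_right (frob_nonneg _) hE
      _ ≤ frob E ^ 2 := h2
  calc frob (-((3 / 4 : ℝ) • E ^ 2) + (1 / 4 : ℝ) • E ^ 3)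
      ≤ frob (-((3 / 4 : ℝ) • E ^ 2)) + frob ((1 / 4 : ℝ) • E ^ 3) := frob_add_le _ _
    _ = 3 / 4 * frob (E ^ 2) + 1 / 4 * frob (E ^ 3) := by
      rw [frob_neg, frob_smul, frob_smul, abs_of_nonneg (by norm_num), abs_of_nonneg (by norm_num)]
    _ ≤ frob E ^ 2 := by linarith

/-- One step of the order-1 Newton–Schulz iteration: the infeasibility satisfies
`Y₁ᵀY₁ − I = −(3/4)E² + (1/4)E³`, and if `‖E‖_F ≤ 1` then `‖Y₁ᵀY₁ − I‖_F ≤ ‖E‖_F²`. -/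
theorem newton_schulz_one_step {n p : ℕ} (Y : Matrix (Fin n) (Fin p) ℝ)
    (E : Matrix (Fin p) (Fin p) ℝ) (hE : E = Yᵀ * Y - 1)
    (Y₁ : Matrix (Fin n) (Fin p) ℝ)
    (hY₁ : Y₁ = Y * ((3 / 2 : ℝ) • (1 : Matrix (Fin p) (Fin p) ℝ) - (1 / 2 : ℝ) • (Yᵀ * Y))) :
    Y₁ᵀ * Y₁ - 1 = -((3 / 4 : ℝ) • E ^ 2) + (1 / 4 : ℝ) • E ^ 3
    ∧ (frob E ≤ 1 → frob (Y₁ᵀ * Y₁ - 1) ≤ (frob E) ^ 2) := by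
  have hG : Yᵀ * Y = 1 + E := by rw [hE]; abel
  have hEt : Eᵀ = E := by simp [hE]
  have hY₁E : Y₁ = Y * (1 - (1 / 2 : ℝ) • E) := by
    rw [hY₁, hG]
    congr 1
    module
  have hcubic : Y₁ᵀ * Y₁ - 1 = -((3 / 4 : ℝ) • E ^ 2) + (1 / 4 : ℝ) • E ^ 3 := by
    calc Y₁ᵀ * Y₁ - 1
        = (1 - (1 / 2 : ℝ) • E) * (Yᵀ * Y) * (1 - (1 / 2 : ℝ) • E) - 1 := by
          simp only [hY₁E, transpose_mul, transpose_sub, transpose_smul, transpose_one, hEt,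
            Matrix.mul_assoc]
      _ = -((3 / 4 : ℝ) • E ^ 2) + (1 / 4 : ℝ) • E ^ 3 := by
          rw [hG]
          simp only [mul_add, add_mul, mul_sub, sub_mul, one_mul, mul_one, smul_mul_assoc,
            mul_smul_comm, pow_succ, pow_zero]
          module
  exact ⟨hcubic, fun h => hcubic ▸ frob_cubic_le h⟩
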